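/- Let ε ∈ (0,1), let p ∈ (0,1) and let n ∈ ℕ satisfy n⁴p⁶ < ε/16. Then with probability at least 1 − ε, every orientation of G(n,p) contains a Seymour vertex. -/

import Mathlib

/-- `D` is an orientation of the simple graph `G`: every arc of `D` lies on an edge of `G`,
and every edge of `G` is given exactly one of its two possible directions. -/
def IsOrientation {V : Type*} (G : SimpleGraph V) (D : V → V → Prop) : Prop :=
  (∀ u v, D u v → G.Adj u v) ∧ ∀ u v, G.Adj u v → (D u v ↔ ¬ D v u)

/-- The first neighborhood (out-neighborhood) of `u` in the digraph `D`. -/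
def firstNbhd {V : Type*} (D : V → V → Prop) (u : V) : Set V := {v | D u v}

/-- The second neighborhood of `u`: vertices whose shortest directed path from `u`
has exactly two arcs. -/
def secondNbhd {V : Type*} (D : V → V → Prop) (u : V) : Set V :=
  {v | ¬ D u v ∧ v ≠ u ∧ ∃ w, D u w ∧ D w v}

/-- A Seymour vertex: its second neighborhood is at least as large as its first. -/
def IsSeymourVertex {V : Type*} (D : V → V → Prop) (u : V) : Prop :=
  (firstNbhd D u).ncard ≤ (secondNbhd D u).ncard

/-- The digraph `D` contains a Seymour vertex. -/
def HasSeymourVertex {V : Type*} (D : V → V → Prop) : Prop :=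
  ∃ u, IsSeymourVertex D u

/- The probability that the binomial random graph `G(n,p)` belongs to the set `S`:
each graph `G` on `{1,…,n}` receives probability `p^{e(G)} (1-p)^{C(n,2)-e(G)}`. -/
open scoped Classical in
noncomputable def gnpProb (n : ℕ) (p : ℝ) (S : Set (SimpleGraph (Fin n))) : ℝ :=
  ∑ G : SimpleGraph (Fin n),
    if G ∈ S then p ^ G.edgeSet.ncard * (1 - p) ^ (n.choose 2 - G.edgeSet.ncard) else 0


open Finset in
open scoped Classical in
/-- the arcs of `D` inside `S` -/
noncomputable def arcsIn {V : Type*} (D : V → V → Prop) (S : Finset V) : Finset (V × V) :=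
  (S ×ˢ S).filter (fun e => D e.1 e.2)

open scoped Classical in
/-- all pairs inside `S` -/
noncomputable def pairsIn {V : Type*} (S : Finset V) : Finset (Sym2 V) :=
  S.offDiag.image (fun e => s(e.1, e.2))

lemma card_pairsIn {V : Type*} (S : Finset V) : (pairsIn S).card = S.card.choose 2 := by
  classical
  have := Sym2.card_image_offDiag S
  rw [← this]
  unfold pairsIn
  congr!

/-- the edges of the arcs inside `S` -/
lemma arcs_edges {V : Type*} {G : SimpleGraph V} {D : V → V → Prop} (hD : IsOrientation G D)
    (S : Finset V) : ∃ T ⊆ pairsIn S, T.card = (arcsIn D S).card ∧ ∀ e ∈ T, e ∈ G.edgeSet := by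
  classical
  refine ⟨(arcsIn D S).image (fun e => s(e.1, e.2)), ?_, ?_, ?_⟩
  · intro e he
    simp only [arcsIn, pairsIn, Finset.mem_image, Finset.mem_filter, Finset.mem_product,
      Finset.mem_offDiag] at he ⊢
    obtain ⟨a, ⟨⟨h1, h2⟩, h3⟩, rfl⟩ := he
    exact ⟨a, ⟨h1, h2, (hD.1 _ _ h3).ne⟩, rfl⟩
  · apply Finset.card_image_of_injOn
    rintro ⟨a, b⟩ ha ⟨c, d⟩ hc hab
    simp only [arcsIn, Finset.coe_filter, Finset.mem_product, Set.mem_ofPred_eq] at ha hc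
    simp only [Sym2.eq_iff] at hab
    rcases hab with ⟨rfl, rfl⟩ | ⟨rfl, rfl⟩
    · rfl
    · exact absurd hc.2 ((hD.2 _ _ (hD.1 _ _ ha.2)).1 ha.2)
  · intro e he
    simp only [arcsIn, Finset.mem_image, Finset.mem_filter] at he
    obtain ⟨a, ⟨_, h3⟩, rfl⟩ := he
    exact hD.1 _ _ h3

lemma arcs_le {V : Type*} {G : SimpleGraph V} {D : V → V → Prop} (hD : IsOrientation G D)
    (S : Finset V) : (arcsIn D S).card ≤ S.card.choose 2 := by
  obtain ⟨T, h1, h2, _⟩ := arcs_edges hD S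
  rw [← h2, ← card_pairsIn]
  exact Finset.card_le_card h1

lemma arcs_erase_sum {V : Type*} [DecidableEq V] {G : SimpleGraph V} {D : V → V → Prop}
    (hD : IsOrientation G D)
    (S : Finset V) : ∑ x ∈ S, (arcsIn D (S.erase x)).card = (arcsIn D S).card * (S.card - 2) := by
  classical
  have h1 : ∀ x ∈ S, (arcsIn D (S.erase x)).card
      = ∑ e ∈ arcsIn D S, if x ≠ e.1 ∧ x ≠ e.2 then 1 else 0 := by
    intro x hx
    rw [← Finset.card_filter]
    congr 1
    ext e
    simp only [arcsIn, Finset.mem_filter, Finset.mem_product, Finset.mem_erase]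
    grind
  rw [Finset.sum_congr rfl h1, Finset.sum_comm, Finset.card_eq_sum_ones, Finset.sum_mul]
  apply Finset.sum_congr rfl
  rintro ⟨a, b⟩ he
  simp only [arcsIn, Finset.mem_filter, Finset.mem_product] at he
  have hab : a ≠ b := (hD.1 _ _ he.2).ne
  rw [← Finset.card_filter, one_mul]
  have : (S.filter fun x => x ≠ a ∧ x ≠ b) = S \ {a, b} := by
    ext x; simp
  rw [this, Finset.card_sdiff_of_subset, Finset.card_pair hab]
  intro x; simp; rintro (rfl | rfl)
  exacts [he.1.1, he.1.2]

lemma exists_seven {V : Type*} {G : SimpleGraph V} {D : V → V → Prop}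
    (hD : IsOrientation G D) (k : ℕ) : ∀ S : Finset V, S.card = k + 7 →
    S.card * (S.card - 1) < 4 * (arcsIn D S).card →
    ∃ S' : Finset V, S'.card = 7 ∧ 11 ≤ (arcsIn D S').card := by
  classical
  induction k with
  | zero =>
    intro S hS h
    refine ⟨S, by simpa using hS, ?_⟩
    rw [hS] at h
    norm_num at h
    omega
  | succ k ih =>
    intro S hS h
    have hsum := arcs_erase_sum hD S
    by_contra hcon
    have hle : ∀ x ∈ S, 4 * (arcsIn D (S.erase x)).card ≤ (k + 7) * (k + 6) := by
      intro x hx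
      by_contra hlt
      have hc : (S.erase x).card = k + 7 := by rw [Finset.card_erase_of_mem hx, hS]; omega
      refine hcon (ih (S.erase x) hc ?_)
      rw [hc]
      simpa using hlt
    have h2 : 4 * ((arcsIn D S).card * (S.card - 2)) ≤ (k + 8) * ((k + 7) * (k + 6)) := by
      rw [← hsum, Finset.mul_sum]
      refine (Finset.sum_le_card_nsmul _ _ _ hle).trans ?_
      rw [hS]; simp [add_assoc]
    rw [hS] at h h2
    have e1 : k + 1 + 7 - 1 = k + 7 := by omega
    have e2 : k + 1 + 7 - 2 = k + 6 := by omega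
    rw [e1] at h
    rw [e2] at h2
    nlinarith

lemma structure_lemma {V : Type*} [Fintype V] [Nonempty V] {G : SimpleGraph V}
    {D : V → V → Prop} (hD : IsOrientation G D) (hns : ¬ HasSeymourVertex D) :
    ∃ (d : ℕ) (S : Finset V), 1 ≤ d ∧ S.card ≤ 2 * d ∧ d * (d + 1) ≤ (arcsIn D S).card := by
  classical
  obtain ⟨u, hu⟩ := Finite.exists_min (fun u : V => (Finset.univ.filter (fun v => D u v)).card)
  set A := Finset.univ.filter (fun v => D u v) with hA
  set B := Finset.univ.filter (fun v => ¬ D u v ∧ v ≠ u ∧ ∃ w, D u w ∧ D w v) with hB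
  have hlt : B.card < A.card := by
    by_contra hcon
    refine hns ⟨u, ?_⟩
    unfold IsSeymourVertex firstNbhd secondNbhd
    have e1 : {v | D u v} = (A : Set V) := by ext; simp [hA]
    have e2 : {v | ¬ D u v ∧ v ≠ u ∧ ∃ w, D u w ∧ D w v} = (B : Set V) := by ext; simp [hB]
    rw [e1, e2, Set.ncard_coe_finset, Set.ncard_coe_finset]
    omega
  have huA : u ∉ A := by
    simp only [hA, Finset.mem_filter, Finset.mem_univ, true_and]
    intro h; exact (hD.1 _ _ h).ne rfl
  refine ⟨A.card, insert u A ∪ B, by omega, ?_, ?_⟩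
  · have := Finset.card_union_le (insert u A) B
    rw [Finset.card_insert_of_notMem huA] at this
    omega
  · have key : ((insert u A).sigma (fun x => Finset.univ.filter (fun v => D x v))).card = ∑ x ∈ insert u A, (Finset.univ.filter (fun v => D x v)).card :=
      Finset.card_sigma _ _
    have h1 : (A.card + 1) * A.card ≤ ∑ x ∈ insert u A, (Finset.univ.filter (fun v => D x v)).card := by
      have := Finset.card_nsmul_le_sum (insert u A) 
        (fun x => (Finset.univ.filter (fun v => D x v)).card) A.card (fun x _ => hu x)
      rwa [Finset.card_insert_of_notMem huA, smul_eq_mul] at this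
    rw [mul_comm]
    refine h1.trans (key ▸ ?_)
    apply Finset.card_le_card_of_injOn (fun e => (e.1, e.2))
    · rintro ⟨x, v⟩ hx
      simp only [Finset.mem_coe, Finset.mem_sigma, Finset.mem_filter, Finset.mem_univ, true_and] at hx
      obtain ⟨hx, hxv⟩ := hx
      simp only [arcsIn, Finset.mem_coe, Finset.mem_filter, Finset.mem_product]
      refine ⟨⟨Finset.mem_union_left _ hx, ?_⟩, hxv⟩
      by_cases huv : D u v
      · apply Finset.mem_union_left; apply Finset.mem_insert_of_mem; simp [hA, huv]
      · rcases Finset.mem_insert.1 hx with rfl | hx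
        · exact absurd hxv huv
        · have hux : D u x := by simpa [hA] using hx
          apply Finset.mem_union_right
          simp only [hB, Finset.mem_filter, Finset.mem_univ, true_and]
          refine ⟨huv, ?_, x, hux, hxv⟩
          rintro rfl
          exact (hD.2 _ _ (hD.1 _ _ hux)).1 hux hxv
    · rintro ⟨x, v⟩ _ ⟨y, w⟩ _ h
      simp only [Prod.mk.injEq] at h
      obtain ⟨rfl, rfl⟩ := h
      rfl

/-- some `k`-set spans at least `m` edges -/
def SpansMany (n k m : ℕ) (G : SimpleGraph (Fin n)) : Prop :=
  ∃ S ∈ Finset.powersetCard k (Finset.univ : Finset (Fin n)),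
    ∃ T ∈ Finset.powersetCard m (pairsIn S), ∀ e ∈ T, e ∈ G.edgeSet

lemma dense_of_arcs {n k m : ℕ} {G : SimpleGraph (Fin n)} {D : Fin n → Fin n → Prop}
    (hD : IsOrientation G D) (S : Finset (Fin n)) (hS : S.card = k)
    (hm : m ≤ (arcsIn D S).card) : SpansMany n k m G := by
  obtain ⟨T, h1, h2, h3⟩ := arcs_edges hD S
  rw [← h2] at hm
  obtain ⟨T', hT', hc⟩ := Finset.exists_subset_card_eq hm
  exact ⟨S, Finset.mem_powersetCard.2 ⟨Finset.subset_univ _, hS⟩, T',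
    Finset.mem_powersetCard.2 ⟨hT'.trans h1, hc⟩, fun e he => h3 e (hT' he)⟩

lemma dense_of_bad {n : ℕ} (hn : 0 < n) {G : SimpleGraph (Fin n)} {D : Fin n → Fin n → Prop}
    (hD : IsOrientation G D) (hns : ¬ HasSeymourVertex D) :
    SpansMany n 4 6 G ∨ SpansMany n 6 12 G ∨ SpansMany n 7 11 G := by
  have : Nonempty (Fin n) := ⟨⟨0, hn⟩⟩
  obtain ⟨d, S, hd, hS, ha⟩ := structure_lemma hD hns
  have hle := arcs_le hD S
  rw [Nat.choose_two_right] at hle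
  have hle2 : 2 * (arcsIn D S).card ≤ S.card * (S.card - 1) := by omega
  rcases Nat.lt_or_ge d 4 with h4 | h4
  · have hs6 : S.card ≤ 6 := by omega
    generalize hs : S.card = s at *
    interval_cases d
    · interval_cases s <;> omega
    · left
      have : s = 4 := by interval_cases s <;> omega
      exact dense_of_arcs hD S (hs.trans this) ha
    · right; left
      have : s = 6 := by interval_cases s <;> omega
      exact dense_of_arcs hD S (hs.trans this) ha
  · right; right
    have h7 : 7 ≤ S.card := by
      by_contra hlt
      have : S.card * (S.card - 1) ≤ 6 * 5 := Nat.mul_le_mul (by omega) (by omega)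
      nlinarith
    obtain ⟨S', h1, h2⟩ := exists_seven hD (S.card - 7) S (by omega) (by
      have : S.card * (S.card - 1) ≤ (2 * d) * (2 * d - 1) := Nat.mul_le_mul hS (by omega)
      obtain ⟨c, rfl⟩ : ∃ c, d = c + 1 := ⟨d - 1, by omega⟩
      have e : 2 * (c + 1) - 1 = 2 * c + 1 := by omega
      rw [e] at this
      nlinarith)
    exact dense_of_arcs hD S' h1 h2

/-- the weight of a graph -/
noncomputable def wt (n : ℕ) (p : ℝ) (G : SimpleGraph (Fin n)) : ℝ :=
  p ^ G.edgeSet.ncard * (1 - p) ^ (n.choose 2 - G.edgeSet.ncard)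

open scoped Classical in
lemma sum_supergraph (n : ℕ) (p : ℝ) (T : Finset (Sym2 (Fin n)))
    (hT : T ⊆ pairsIn Finset.univ) :
    ∑ G : SimpleGraph (Fin n), (if (∀ e ∈ T, e ∈ G.edgeSet) then wt n p G else 0) = p ^ T.card := by
  have hE : ∀ e : Sym2 (Fin n), e ∈ pairsIn (Finset.univ : Finset (Fin n)) ↔ ¬ e.IsDiag := by
    intro e
    induction e with | _ a b => 
    simp only [pairsIn, Finset.mem_image, Finset.mem_offDiag, Finset.mem_univ, true_and,
      Sym2.mk_isDiag_iff]
    constructor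
    · rintro ⟨⟨x, y⟩, h, h'⟩
      rw [Sym2.eq_iff] at h'
      rcases h' with ⟨rfl, rfl⟩ | ⟨rfl, rfl⟩
      · exact h
      · exact fun h'' => h h''.symm
    · intro h; exact ⟨(a, b), h, rfl⟩
  set E := pairsIn (Finset.univ : Finset (Fin n)) with hEdef
  have hEc : E.card = n.choose 2 := by rw [hEdef, card_pairsIn]; simp
  have h2 := Finset.sum_pow_mul_eq_add_pow p (1 - p) (E \ T)
  rw [add_sub_cancel, one_pow] at h2
  rw [← mul_one (p ^ T.card), ← h2, Finset.mul_sum, ← Finset.sum_filter]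
  symm
  have hcd : (E \ T).card = E.card - T.card := Finset.card_sdiff_of_subset hT
  have hTE := Finset.card_le_card hT
  have hes : ∀ Y ∈ (E \ T).powerset,
      (SimpleGraph.fromEdgeSet ((Y ∪ T : Finset _) : Set (Sym2 (Fin n)))).edgeSet
        = ((Y ∪ T : Finset _) : Set (Sym2 (Fin n))) := by
    intro Y hY
    rw [SimpleGraph.edgeSet_fromEdgeSet]
    ext e
    simp only [Set.mem_sdiff, Finset.mem_coe]
    refine ⟨fun h => h.1, fun h => ⟨h, ?_⟩⟩
    have : e ∈ E := by
      rcases Finset.mem_union.1 h with h | h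
      · exact (Finset.mem_sdiff.1 (Finset.mem_powerset.1 hY h)).1
      · exact hT h
    exact (hE e).1 this
  have hdisj : ∀ Y ∈ (E \ T).powerset, Disjoint Y T := by
    intro Y hY
    exact Finset.disjoint_of_subset_left (Finset.mem_powerset.1 hY) Finset.sdiff_disjoint
  refine Finset.sum_bij' (fun Y _ => SimpleGraph.fromEdgeSet ((Y ∪ T : Finset _) : Set (Sym2 (Fin n))))
    (fun G _ => G.edgeFinset \ T) ?_ ?_ ?_ ?_ ?_
  · intro Y hY
    simp only [Finset.mem_filter, Finset.mem_univ, true_and]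
    intro e he
    rw [hes Y hY]
    simp [he]
  · intro G hG
    rw [Finset.mem_powerset]
    apply Finset.sdiff_subset_sdiff _ (le_refl _)
    intro e he
    rw [hE]
    exact G.not_isDiag_of_mem_edgeSet (SimpleGraph.mem_edgeFinset.1 he)
  · intro Y hY
    ext e
    have := hes Y hY
    have hd : e ∈ Y → e ∉ T := fun he => Finset.disjoint_left.1 (hdisj Y hY) he
    simp only [Finset.mem_sdiff, SimpleGraph.mem_edgeFinset, this, Finset.mem_coe, Finset.mem_union]
    tauto
  · intro G hG
    simp only [Finset.mem_filter, Finset.mem_univ, true_and] at hG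
    have : ((G.edgeFinset \ T ∪ T : Finset _) : Set (Sym2 (Fin n))) = G.edgeSet := by
      ext e
      have := hG e
      simp only [Finset.mem_coe, Finset.mem_union, Finset.mem_sdiff, SimpleGraph.mem_edgeFinset]
      tauto
    simp only [this, SimpleGraph.fromEdgeSet_edgeSet]
  · intro Y hY
    unfold wt
    rw [hes Y hY, Set.ncard_coe_finset, Finset.card_union_of_disjoint (hdisj Y hY), hcd, ← hEc,
      pow_add]
    have : E.card - (Y.card + T.card) = E.card - T.card - Y.card := by omega
    rw [this]
    ring

lemma wt_nonneg (n : ℕ) (p : ℝ) (hp : p ∈ Set.Ioo (0 : ℝ) 1) (G : SimpleGraph (Fin n)) :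
    0 ≤ wt n p G :=
  mul_nonneg (pow_nonneg hp.1.le _) (pow_nonneg (sub_nonneg.2 hp.2.le) _)

open scoped Classical in
lemma prob_dense (n k m : ℕ) (p : ℝ) (hp : p ∈ Set.Ioo (0 : ℝ) 1) :
    ∑ G : SimpleGraph (Fin n), (if SpansMany n k m G then wt n p G else 0)
      ≤ (n.choose k : ℝ) * ((k.choose 2).choose m : ℝ) * p ^ m := by
  have h1 : ∀ G : SimpleGraph (Fin n), (if SpansMany n k m G then wt n p G else 0) ≤
      ∑ S ∈ Finset.powersetCard k (Finset.univ : Finset (Fin n)),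
        ∑ T ∈ Finset.powersetCard m (pairsIn S),
          (if (∀ e ∈ T, e ∈ G.edgeSet) then wt n p G else 0) := by
    intro G
    have hnn : ∀ T : Finset (Sym2 (Fin n)),
        0 ≤ (if (∀ e ∈ T, e ∈ G.edgeSet) then wt n p G else 0) := by
      intro T
      split_ifs
      exacts [wt_nonneg n p hp G, le_refl _]
    split_ifs with h
    · obtain ⟨S, hS, T, hT, hTG⟩ := h
      refine le_trans ?_ (Finset.single_le_sum 
        (f := fun S => ∑ T ∈ Finset.powersetCard m (pairsIn S),
          (if (∀ e ∈ T, e ∈ G.edgeSet) then wt n p G else 0))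
        (fun S _ => Finset.sum_nonneg fun T _ => hnn T) hS)
      refine le_trans ?_ (Finset.single_le_sum 
        (f := fun T : Finset (Sym2 (Fin n)) => (if (∀ e ∈ T, e ∈ G.edgeSet) then wt n p G else 0))
        (fun T _ => hnn T) hT)
      simp only [if_pos hTG, le_refl]
    · exact Finset.sum_nonneg fun S _ => Finset.sum_nonneg fun T _ => hnn T
  refine (Finset.sum_le_sum fun G _ => h1 G).trans ?_
  rw [Finset.sum_comm]
  have h2 : ∀ S ∈ Finset.powersetCard k (Finset.univ : Finset (Fin n)),
      ∑ G : SimpleGraph (Fin n), ∑ T ∈ Finset.powersetCard m (pairsIn S),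
          (if (∀ e ∈ T, e ∈ G.edgeSet) then wt n p G else 0)
        = ((k.choose 2).choose m : ℝ) * p ^ m := by
    intro S hS
    rw [Finset.sum_comm]
    have h3 : ∀ T ∈ Finset.powersetCard m (pairsIn S),
        ∑ G : SimpleGraph (Fin n), (if (∀ e ∈ T, e ∈ G.edgeSet) then wt n p G else 0) = p ^ m := by
      intro T hT
      obtain ⟨hT1, hT2⟩ := Finset.mem_powersetCard.1 hT
      rw [sum_supergraph, hT2]
      refine hT1.trans ?_
      intro e he
      simp only [pairsIn, Finset.mem_image, Finset.mem_offDiag, Finset.mem_univ, true_and] at he ⊢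
      obtain ⟨a, ha, rfl⟩ := he
      exact ⟨a, ha.2.2, rfl⟩
    rw [Finset.sum_congr rfl h3, Finset.sum_const, Finset.card_powersetCard, card_pairsIn,
      (Finset.mem_powersetCard.1 hS).2, nsmul_eq_mul]
  rw [Finset.sum_congr rfl h2, Finset.sum_const, Finset.card_powersetCard, nsmul_eq_mul]
  simp [mul_assoc]

lemma numerics (ε p : ℝ) (hε : ε ∈ Set.Ioo (0 : ℝ) 1) (hp : p ∈ Set.Ioo (0 : ℝ) 1)
    (n : ℕ) (h : (n : ℝ) ^ 4 * p ^ 6 < ε / 16) :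
    (n.choose 4 : ℝ) * ((Nat.choose 4 2).choose 6 : ℝ) * p ^ 6
    + (n.choose 6 : ℝ) * ((Nat.choose 6 2).choose 12 : ℝ) * p ^ 12
    + (n.choose 7 : ℝ) * ((Nat.choose 7 2).choose 11 : ℝ) * p ^ 11 ≤ ε := by
  obtain ⟨hp0, hp1⟩ := hp
  obtain ⟨he0, he1⟩ := hε
  have c1 : (Nat.choose 4 2).choose 6 = 1 := by decide
  have c2 : (Nat.choose 6 2).choose 12 = 455 := by
    simp [Nat.choose]
  have c3 : (Nat.choose 7 2).choose 11 = 352716 := by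
    simp [Nat.choose]
  rw [c1, c2, c3]
  have b4 := Nat.choose_le_pow_div (α := ℝ) 4 n
  have b6 := Nat.choose_le_pow_div (α := ℝ) 6 n
  have b7 := Nat.choose_le_pow_div (α := ℝ) 7 n
  norm_num [Nat.factorial] at b4 b6 b7
  set x : ℝ := (n : ℝ) with hx
  have hx0 : 0 ≤ x := Nat.cast_nonneg n
  -- y = n^2 p^3
  have hy0 : 0 ≤ x ^ 2 * p ^ 3 := by positivity
  have hy : x ^ 2 * p ^ 3 < 1 / 4 := by
    by_contra hc
    push Not at hc
    have : (x ^ 2 * p ^ 3) ^ 2 = x ^ 4 * p ^ 6 := by ring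
    nlinarith
  have t1 : (n.choose 4 : ℝ) * (1 : ℕ) * p ^ 6 ≤ ε / 16 := by
    have : (n.choose 4 : ℝ) * p ^ 6 ≤ x ^ 4 / 24 * p ^ 6 := by gcongr
    have h0 : 0 ≤ x ^ 4 * p ^ 6 := by positivity
    push_cast
    linarith
  have t2 : (n.choose 6 : ℝ) * (455 : ℕ) * p ^ 12 ≤ ε / 16 := by
    have h1 : (n.choose 6 : ℝ) * p ^ 12 ≤ x ^ 6 / 720 * p ^ 12 := by gcongr
    have h2 : x ^ 6 * p ^ 12 = (x ^ 4 * p ^ 6) * ((x ^ 2 * p ^ 3) * p ^ 3) := by ring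
    have h3 : p ^ 3 ≤ 1 := pow_le_one₀ hp0.le hp1.le
    have h4 : (x ^ 2 * p ^ 3) * p ^ 3 ≤ 1 / 4 := by
      have : 0 ≤ p ^ 3 := by positivity
      nlinarith
    have h5 : x ^ 6 * p ^ 12 ≤ ε / 16 * (1 / 4) := by
      rw [h2]
      exact mul_le_mul h.le h4 (by positivity) (by linarith)
    push_cast
    linarith
  have t3 : (n.choose 7 : ℝ) * (352716 : ℕ) * p ^ 11 ≤ ε / 4 := by
    rcases Nat.lt_or_ge n 7 with h7 | h7
    · rw [Nat.choose_eq_zero_of_lt h7]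
      simp; linarith
    have hx7 : (7 : ℝ) ≤ x := by rw [hx]; exact_mod_cast h7
    have h1 : (n.choose 7 : ℝ) * p ^ 11 ≤ x ^ 7 / 5040 * p ^ 11 := by gcongr
    have hp5 : p ≤ 1 / 5 := by
      by_contra hc
      push Not at hc
      have a1 : (49 : ℝ) * (1 / 5) ^ 3 ≤ x ^ 2 * p ^ 3 := by
        have : (49 : ℝ) ≤ x ^ 2 := by nlinarith
        gcongr
      norm_num at a1
      linarith
    have h2 : (x ^ 7 * p ^ 11) ^ 2 = (x ^ 4 * p ^ 6) ^ 3 * ((x ^ 2 * p ^ 3) * p) := by ring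
    have h3 : (x ^ 7 * p ^ 11) ^ 2 ≤ (ε / 16) ^ 3 * (1 / 4 * (1 / 5)) := by
      rw [h2]
      gcongr
    have h4 : x ^ 7 * p ^ 11 ≤ ε / 285 := by
      apply le_of_sq_le_sq _ (by positivity)
      refine h3.trans ?_
      have : ε ^ 3 ≤ ε ^ 2 := by nlinarith [sq_nonneg ε]
      nlinarith [sq_nonneg ε]
    push_cast
    linarith
  calc _ ≤ ε / 16 + ε / 16 + ε / 4 := add_le_add (add_le_add t1 t2) t3
    _ ≤ ε := by linarith

/-- If `ε ∈ (0,1)`, `p ∈ (0,1)` and `n⁴p⁶ < ε/16`, then with probability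
at least `1 − ε` every orientation of `G(n,p)` contains a Seymour vertex. -/
theorem snc_gnp_small_p (ε p : ℝ) (hε : ε ∈ Set.Ioo (0 : ℝ) 1) (hp : p ∈ Set.Ioo (0 : ℝ) 1)
    (n : ℕ) (hn : 0 < n) (h : (n : ℝ) ^ 4 * p ^ 6 < ε / 16) :
    1 - ε ≤ gnpProb n p
      {G | ∀ D : Fin n → Fin n → Prop, IsOrientation G D → HasSeymourVertex D} := by
  classical
  have htot := sum_supergraph n p ∅ (Finset.empty_subset _)
  simp only [Finset.notMem_empty, false_implies, implies_true, if_true, Finset.card_empty,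
    pow_zero] at htot
  have hnum := numerics ε p hε hp n h
  have d1 := prob_dense n 4 6 p hp
  have d2 := prob_dense n 6 12 p hp
  have d3 := prob_dense n 7 11 p hp
  suffices hs : 1 ≤ gnpProb n p
      {G | ∀ D : Fin n → Fin n → Prop, IsOrientation G D → HasSeymourVertex D}
      + ((∑ G : SimpleGraph (Fin n), (if SpansMany n 4 6 G then wt n p G else 0))
      + (∑ G : SimpleGraph (Fin n), (if SpansMany n 6 12 G then wt n p G else 0))
      + (∑ G : SimpleGraph (Fin n), (if SpansMany n 7 11 G then wt n p G else 0))) by linarith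
  rw [← htot]
  unfold gnpProb
  rw [← Finset.sum_add_distrib, ← Finset.sum_add_distrib, ← Finset.sum_add_distrib]
  apply Finset.sum_le_sum
  intro G _
  have hw := wt_nonneg n p hp G
  rw [show p ^ G.edgeSet.ncard * (1 - p) ^ (n.choose 2 - G.edgeSet.ncard) = wt n p G from rfl]
  by_cases hG : G ∈ {G | ∀ D : Fin n → Fin n → Prop, IsOrientation G D → HasSeymourVertex D}
  · rw [if_pos hG]
    split_ifs <;> linarith
  · rw [if_neg hG]
    simp only [Set.mem_ofPred_eq, not_forall] at hG
    obtain ⟨D, hD, hns⟩ := hG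
    rcases dense_of_bad hn hD hns with h' | h' | h' <;> rw [if_pos h'] <;> split_ifs <;> linarith
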